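/- arXiv:2307.09409 — 6 statements merged into one kernel-verified Lean document; each statement's English description precedes it below -/
import Mathlib

section
/- Every element of finite order in SL(2,ℤ) is conjugate in SL(2,ℤ) to one of the eight matrices I, −I, U, −U, V, −V, V², −V². (Equivalently, every finite-order element of PSL(2,ℤ) is conjugate to one of 1, U, V, V².) -/
/-- The matrix `U`, rotation of order 4 in `SL(2, ℤ)`. -/
def U : Matrix.SpecialLinearGroup (Fin 2) ℤ :=
  ⟨!![0, -1; 1, 0], by norm_num [Matrix.det_fin_two_of]⟩

/-- The matrix `V`, rotation of order 3 in `SL(2, ℤ)`. -/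
def V : Matrix.SpecialLinearGroup (Fin 2) ℤ :=
  ⟨!![0, -1; 1, -1], by norm_num [Matrix.det_fin_two_of]⟩

open Matrix in
/-- If the trace has absolute value at least two, finite order forces a scalar matrix. -/
theorem pow_form (A : Matrix (Fin 2) (Fin 2) ℤ) (hdet : A 0 0 * A 1 1 - A 0 1 * A 1 0 = 1)
    (ht : 2 ≤ |A 0 0 + A 1 1|) (n : ℕ) :
    ∃ x y : ℤ, A ^ (n + 1) = x • A - y • (1 : Matrix (Fin 2) (Fin 2) ℤ) ∧ |y| + 1 ≤ |x| := by
  induction n with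
  | zero => exact ⟨1, 0, by simp, by simp⟩
  | succ n ih =>
    obtain ⟨x, y, h, hxy⟩ := ih
    refine ⟨(A 0 0 + A 1 1) * x - y, x, ?_, ?_⟩
    · rw [pow_succ, h]
      ext i j
      fin_cases i <;> fin_cases j <;> simp [-zsmul_eq_mul, -zsmul_one, Matrix.smul_apply, Matrix.mul_apply, Fin.sum_univ_two]
      · linear_combination (-x) * hdet
      · ring
      · ring
      · linear_combination (-x) * hdet
    · have h1 := abs_sub_abs_le_abs_sub ((A 0 0 + A 1 1) * x) y
      rw [abs_mul] at h1
      nlinarith [abs_nonneg x]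

/-- The product `(1 k; 0 1)`. -/
def Tk (k : ℤ) : Matrix.SpecialLinearGroup (Fin 2) ℤ :=
  ⟨!![1, k; 0, 1], by norm_num [Matrix.det_fin_two_of]⟩

theorem conj_Tk (A : Matrix.SpecialLinearGroup (Fin 2) ℤ) (k : ℤ) :
    (Tk k * A * (Tk k)⁻¹).1 = !![A.1 0 0 + k * A.1 1 0,
      A.1 0 1 + k * A.1 1 1 - k * (A.1 0 0 + k * A.1 1 0); A.1 1 0, A.1 1 1 - k * A.1 1 0] := by
  have hT : (Tk k).1 = !![1, k; 0, 1] := rfl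
  rw [Matrix.SpecialLinearGroup.coe_mul, Matrix.SpecialLinearGroup.coe_mul,
    Matrix.SpecialLinearGroup.coe_inv, hT]
  ext i j
  fin_cases i <;> fin_cases j <;>
    simp [Matrix.mul_apply, Fin.sum_univ_two, Matrix.vecMul, dotProduct,
      Matrix.adjugate_fin_two] <;> ring

theorem conj_U (A : Matrix.SpecialLinearGroup (Fin 2) ℤ) :
    (U * A * U⁻¹).1 = !![A.1 1 1, - A.1 1 0; - A.1 0 1, A.1 0 0] := by
  have hT : U.1 = !![0, -1; 1, 0] := rfl
  rw [Matrix.SpecialLinearGroup.coe_mul, Matrix.SpecialLinearGroup.coe_mul,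
    Matrix.SpecialLinearGroup.coe_inv, hT]
  ext i j
  fin_cases i <;> fin_cases j <;>
    simp [Matrix.mul_apply, Fin.sum_univ_two, Matrix.vecMul, dotProduct,
      Matrix.adjugate_fin_two]

theorem exists_small (a c : ℤ) (hc : c ≠ 0) :
    ∃ k : ℤ, 2 * |a + k * c| ≤ |c| := by
  have hpos : 0 < |c| := abs_pos.mpr hc
  have h0 := Int.emod_nonneg a hc
  have h1 := Int.emod_lt_abs a hc
  have h2 := Int.emod_add_mul_ediv a c
  by_cases h : 2 * (a % c) ≤ |c|
  · refine ⟨-(a / c), ?_⟩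
    have : a + -(a / c) * c = a % c := by linear_combination -h2
    rw [this, abs_of_nonneg h0]; exact h
  · rcases abs_choice c with hs | hs
    · refine ⟨-(a / c) - 1, ?_⟩
      have : a + (-(a / c) - 1) * c = a % c - |c| := by rw [hs]; linear_combination -h2
      rw [this, abs_of_nonpos (by omega)]; omega
    · refine ⟨-(a / c) + 1, ?_⟩
      have : a + (-(a / c) + 1) * c = a % c - |c| := by rw [hs]; linear_combination -h2
      rw [this, abs_of_nonpos (by omega)]; omega

theorem descent (n : ℕ) : ∀ A : Matrix.SpecialLinearGroup (Fin 2) ℤ,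
    |A.1 0 0 + A.1 1 1| ≤ 1 → (A.1 1 0).natAbs ≤ n →
    ∃ B : Matrix.SpecialLinearGroup (Fin 2) ℤ, |(B * A * B⁻¹).1 0 0 + (B * A * B⁻¹).1 1 1| ≤ 1 ∧
      |(B * A * B⁻¹).1 1 0| = 1 := by
  induction n with
  | zero =>
    intro A ht hc
    have hd := A.2
    rw [Matrix.det_fin_two] at hd
    have hc : A.1 1 0 = 0 := by omega
    rw [hc] at hd
    have : A.1 0 0 * A.1 1 1 = 1 := by linarith
    rcases Int.mul_eq_one_iff_eq_one_or_neg_one.mp this with ⟨h1, h2⟩ | ⟨h1, h2⟩ <;>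
      rw [h1, h2] at ht <;> norm_num at ht
  | succ n ih =>
    intro A ht hc
    by_cases hn : (A.1 1 0).natAbs ≤ n
    · exact ih A ht hn
    by_cases h1 : |A.1 1 0| = 1
    · exact ⟨1, by simpa using ht, by simpa using h1⟩
    have habs := Int.abs_eq_natAbs (A.1 1 0)
    have hc0 : A.1 1 0 ≠ 0 := by omega
    have hc2 : 2 ≤ |A.1 1 0| := by omega
    obtain ⟨k, hk⟩ := exists_small (A.1 0 0) _ hc0
    set A' := Tk k * A * (Tk k)⁻¹ with hA'
    have e := conj_Tk A k
    rw [← hA'] at e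
    have e00 : A'.1 0 0 = A.1 0 0 + k * A.1 1 0 := by rw [e]; simp
    have e10 : A'.1 1 0 = A.1 1 0 := by rw [e]; simp
    have e11 : A'.1 1 1 = A.1 1 1 - k * A.1 1 0 := by rw [e]; simp
    have f := conj_U A'
    have hd := A'.2
    rw [Matrix.det_fin_two] at hd
    have ht' : |A'.1 0 0 + A'.1 1 1| ≤ 1 := by
      rw [e00, e11]; convert ht using 2; ring
    rw [← e00] at hk
    rw [← e10] at hk hc2
    have hb : |A'.1 0 1| < |A'.1 1 0| := by
      by_contra hcon
      push Not at hcon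
      have hp : |A'.1 0 1| * |A'.1 1 0| = |A'.1 0 0 * A'.1 1 1 - 1| := by
        rw [← abs_mul]; congr 1; linarith
      have hq : |A'.1 0 0 * A'.1 1 1 - 1| ≤ |A'.1 0 0| * |A'.1 1 1| + 1 := by
        have := abs_sub (A'.1 0 0 * A'.1 1 1) 1
        rwa [abs_mul, abs_one] at this
      have hr : |A'.1 1 1| ≤ |A'.1 0 0| + 1 := by
        have := abs_sub (A'.1 0 0 + A'.1 1 1) (A'.1 0 0)
        rw [add_sub_cancel_left] at this
        linarith
      nlinarith [abs_nonneg (A'.1 0 0), abs_nonneg (A'.1 1 1)]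
    obtain ⟨B, hB1, hB2⟩ := ih (U * A' * U⁻¹) (by rw [f]; simpa [add_comm] using ht')
      (by
        have q1 := Int.abs_eq_natAbs (A'.1 0 1)
        rw [e10] at hb
        rw [f]; simp; omega)
    refine ⟨B * U * Tk k, ?_⟩
    have : B * U * Tk k * A * (B * U * Tk k)⁻¹ = B * (U * A' * U⁻¹) * B⁻¹ := by
      rw [hA']; group
    rw [this]
    exact ⟨hB1, hB2⟩

theorem sl_ext (A B : Matrix.SpecialLinearGroup (Fin 2) ℤ) (h00 : A.1 0 0 = B.1 0 0)
    (h01 : A.1 0 1 = B.1 0 1) (h10 : A.1 1 0 = B.1 1 0) (h11 : A.1 1 1 = B.1 1 1) : A = B := by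
  ext i j
  fin_cases i <;> fin_cases j <;> assumption

theorem base (A : Matrix.SpecialLinearGroup (Fin 2) ℤ) (ht : |A.1 0 0 + A.1 1 1| ≤ 1)
    (hc : |A.1 1 0| = 1) :
    ∃ B : Matrix.SpecialLinearGroup (Fin 2) ℤ,
      B * A * B⁻¹ ∈ ({1, -1, U, -U, V, -V, V ^ 2, -(V ^ 2)} :
        Set (Matrix.SpecialLinearGroup (Fin 2) ℤ)) := by
  have hd := A.2
  rw [Matrix.det_fin_two] at hd
  have key : ∀ (k : ℤ) (M : Matrix.SpecialLinearGroup (Fin 2) ℤ),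
      A.1 0 0 + k * A.1 1 0 = M.1 0 0 → A.1 1 0 = M.1 1 0 → A.1 0 0 + A.1 1 1 = M.1 0 0 + M.1 1 1 →
      Tk k * A * (Tk k)⁻¹ = M := by
    intro k M h1 h2 h3
    have hM := M.2
    rw [Matrix.det_fin_two] at hM
    have e := conj_Tk A k
    have hd' := (Tk k * A * (Tk k)⁻¹).2
    rw [Matrix.det_fin_two] at hd'
    have e00 : (Tk k * A * (Tk k)⁻¹).1 0 0 = M.1 0 0 := by rw [e]; simpa using h1
    have e10 : (Tk k * A * (Tk k)⁻¹).1 1 0 = M.1 1 0 := by rw [e]; simpa using h2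
    have e11 : (Tk k * A * (Tk k)⁻¹).1 1 1 = M.1 1 1 := by rw [e]; simp; linarith
    refine sl_ext _ _ e00 ?_ e10 e11
    rw [e00, e10, e11] at hd'
    have h0 : M.1 1 0 ≠ 0 := by
      rw [← h2]; intro h; rw [h] at hc; simp at hc
    apply mul_right_cancel₀ h0
    linarith
  have hV : (V ^ 2).1 = !![-1, 1; -1, 0] := by
    have hv : V.1 = !![0, -1; 1, -1] := rfl
    rw [pow_two, Matrix.SpecialLinearGroup.coe_mul, hv]; simp
  rw [abs_le] at ht
  have ht3 : A.1 0 0 + A.1 1 1 = 0 ∨ A.1 0 0 + A.1 1 1 = 1 ∨ A.1 0 0 + A.1 1 1 = -1 := by omega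
  have hV00 : (V ^ 2).1 0 0 = -1 := by rw [hV]; rfl
  have hV10 : (V ^ 2).1 1 0 = -1 := by rw [hV]; rfl
  have hV11 : (V ^ 2).1 1 1 = 0 := by rw [hV]; rfl
  have n00 : ∀ M : Matrix.SpecialLinearGroup (Fin 2) ℤ, ∀ i j, (-M).1 i j = - M.1 i j :=
    fun M i j => rfl
  have u00 : U.1 0 0 = 0 := rfl
  have u10 : U.1 1 0 = 1 := rfl
  have u11 : U.1 1 1 = 0 := rfl
  have v00 : V.1 0 0 = 0 := rfl
  have v10 : V.1 1 0 = 1 := rfl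
  have v11 : V.1 1 1 = -1 := rfl
  rcases (abs_eq (by norm_num : (0:ℤ) ≤ 1)).mp hc with h | h <;> rcases ht3 with t | t | t
  · exact ⟨_, by rw [key (-A.1 0 0) U (by rw [u00, h]; ring) (by rw [u10, h]) (by rw [u00, u11, t]; rfl)]; simp⟩
  · exact ⟨_, by rw [key (-A.1 0 0 + 1) (-(V ^ 2)) (by rw [n00, hV00, h]; ring) (by rw [n00, hV10, h]; rfl) (by rw [n00, n00, hV00, hV11, t]; rfl)]; simp⟩
  · exact ⟨_, by rw [key (-A.1 0 0) V (by rw [v00, h]; ring) (by rw [v10, h]) (by rw [v00, v11, t]; rfl)]; simp⟩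
  · exact ⟨_, by rw [key (A.1 0 0) (-U) (by rw [n00, u00, h]; ring) (by rw [n00, u10, h]) (by rw [n00, n00, u00, u11, t]; rfl)]; simp⟩
  · exact ⟨_, by rw [key (A.1 0 0) (-V) (by rw [n00, v00, h]; ring) (by rw [n00, v10, h]) (by rw [n00, n00, v00, v11, t]; rfl)]; simp⟩
  · exact ⟨_, by rw [key (A.1 0 0 + 1) (V ^ 2) (by rw [hV00, h]; ring) (by rw [hV10, h]) (by rw [hV00, hV11, t]; rfl)]; simp⟩

/-- Every element of finite order in `SL(2, ℤ)` is conjugate to one of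
`I, -I, U, -U, V, -V, V², -V²`. -/
theorem finite_order_conjugate (A : Matrix.SpecialLinearGroup (Fin 2) ℤ)
    (hA : IsOfFinOrder A) :
    ∃ B : Matrix.SpecialLinearGroup (Fin 2) ℤ,
      B * A * B⁻¹ ∈ ({1, -1, U, -U, V, -V, V ^ 2, -(V ^ 2)} :
        Set (Matrix.SpecialLinearGroup (Fin 2) ℤ)) := by
  by_cases ht : |A.1 0 0 + A.1 1 1| ≤ 1
  · obtain ⟨B, h1, h2⟩ := descent _ A ht le_rfl
    obtain ⟨C, hC⟩ := base _ h1 h2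
    refine ⟨C * B, ?_⟩
    have : C * B * A * (C * B)⁻¹ = C * (B * A * B⁻¹) * C⁻¹ := by group
    rwa [this]
  · refine ⟨1, ?_⟩
    have hd := A.2
    rw [Matrix.det_fin_two] at hd
    obtain ⟨n, hn, hAn⟩ := isOfFinOrder_iff_pow_eq_one.mp hA
    obtain ⟨m, rfl⟩ : ∃ m, n = m + 1 := ⟨n - 1, by omega⟩
    obtain ⟨x, y, h, hxy⟩ := pow_form A.1 hd (by omega) m
    have hx : x ≠ 0 := by
      rintro rfl
      have := abs_nonneg y
      simp at hxy
      omega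
    have hA1 : A.1 ^ (m + 1) = 1 := by
      have := congrArg Subtype.val hAn
      simpa using this
    rw [hA1] at h
    have g00 := congrFun (congrFun h 0) 0
    have g01 := congrFun (congrFun h 0) 1
    have g10 := congrFun (congrFun h 1) 0
    have g11 := congrFun (congrFun h 1) 1
    simp [-zsmul_eq_mul, -zsmul_one, Matrix.smul_apply, hx] at g00 g01 g10 g11
    have h01 : A.1 0 1 = 0 := g01
    have h10 : A.1 1 0 = 0 := g10
    have h11 : A.1 1 1 = A.1 0 0 := mul_left_cancel₀ hx (by linarith)
    rw [h01, h10, h11] at hd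
    have h2 : A.1 0 0 * A.1 0 0 = 1 := by linarith
    rcases mul_self_eq_one_iff.mp h2 with h3 | h3
    · have : A = 1 := sl_ext _ _ h3 h01 h10 (h11.trans h3)
      simp [this]
    · have : A = -1 := sl_ext _ _ h3 h01 h10 (h11.trans h3)
      simp [this]
end

section
/- Let M₁, M₂, …, M_k be a finite sequence of matrices in SL(2,ℤ) such that each Mᵢ is equal to L or to R, at least one Mᵢ equals L, and at least one Mᵢ equals R. Then the trace of the product M₁·M₂·⋯·M_k is strictly greater than 2; that is, any word in positive powers of R and L involving both letters is a hyperbolic element of the modular group. -/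
/-- The matrix `L` in `SL(2, ℤ)`. -/
def L : Matrix.SpecialLinearGroup (Fin 2) ℤ :=
  ⟨!![1, 1; 0, 1], by norm_num [Matrix.det_fin_two_of]⟩

/-- The matrix `R` in `SL(2, ℤ)`. -/
def R : Matrix.SpecialLinearGroup (Fin 2) ℤ :=
  ⟨!![1, 0; 1, 1], by norm_num [Matrix.det_fin_two_of]⟩

/-- Entrywise bounds for a product of letters `L`, `R`. -/
theorem word_entries (l : List (Matrix.SpecialLinearGroup (Fin 2) ℤ))
    (hLR : ∀ M ∈ l, M = L ∨ M = R) :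
    1 ≤ l.prod.1 0 0 ∧ 1 ≤ l.prod.1 1 1 ∧ 0 ≤ l.prod.1 0 1 ∧ 0 ≤ l.prod.1 1 0 ∧
      (L ∈ l → 1 ≤ l.prod.1 0 1) ∧ (R ∈ l → 1 ≤ l.prod.1 1 0) := by
  have hne : L ≠ R := by
    intro h
    have := congrArg (fun M : Matrix.SpecialLinearGroup (Fin 2) ℤ => M.1 0 1) h
    simp [L, R] at this
  induction l with
  | nil => simp
  | cons M l ih =>
    obtain ⟨h1, h2, h3, h4, h5, h6⟩ := ih (fun N hN => hLR N (List.mem_cons_of_mem _ hN))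
    have e : (M :: l).prod.1 = M.1 * l.prod.1 := by
      rw [List.prod_cons]; rfl
    rw [e]
    simp only [List.mem_cons, Matrix.mul_apply, Fin.sum_univ_two]
    rcases hLR M List.mem_cons_self with rfl | rfl
    · have a : L.1 0 0 = 1 := rfl
      have b : L.1 0 1 = 1 := rfl
      have c : L.1 1 0 = 0 := rfl
      have d : L.1 1 1 = 1 := rfl
      rw [a, b, c, d]
      refine ⟨by linarith, by linarith, by linarith, by linarith, fun _ => by linarith, ?_⟩
      rintro (h | h)
      · exact absurd h.symm hne
      · linarith [h6 h]
    · have a : R.1 0 0 = 1 := rfl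
      have b : R.1 0 1 = 0 := rfl
      have c : R.1 1 0 = 1 := rfl
      have d : R.1 1 1 = 1 := rfl
      rw [a, b, c, d]
      refine ⟨by linarith, by linarith, by linarith, by linarith, ?_, fun _ => by linarith⟩
      rintro (h | h)
      · exact absurd h hne
      · linarith [h5 h]

/-- Any word in positive powers of `R` and `L` involving both letters is a
hyperbolic element of the modular group: its trace is strictly greater than 2.
The word `M₁ ⋯ M_k` is encoded as a list of matrices each equal to `L` or `R`,
containing at least one `L` and at least one `R`. -/
theorem trace_word_gt_two (l : List (Matrix.SpecialLinearGroup (Fin 2) ℤ))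
    (hLR : ∀ M ∈ l, M = L ∨ M = R) (hL : L ∈ l) (hR : R ∈ l) :
    2 < Matrix.trace ((l.prod : Matrix.SpecialLinearGroup (Fin 2) ℤ) :
      Matrix (Fin 2) (Fin 2) ℤ) := by
  obtain ⟨h1, h2, _, _, h5, h6⟩ := word_entries l hLR
  have hb := h5 hL
  have hc := h6 hR
  have hd := l.prod.2
  rw [Matrix.det_fin_two] at hd
  rw [Matrix.trace_fin_two]
  by_contra hcon
  have ha1 : l.prod.1 0 0 = 1 := by linarith
  have hd1 : l.prod.1 1 1 = 1 := by linarith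
  rw [ha1, hd1] at hd
  nlinarith
end

section
/- If A ∈ SL(2,ℤ) has trace(A) > 2, then there exist B ∈ SL(2,ℤ) and a finite sequence M₁, M₂, …, M_k of matrices, each equal to L or to R, with at least one Mᵢ equal to L and at least one Mᵢ equal to R, such that B·A·B⁻¹ = M₁·M₂·⋯·M_k. (Up to conjugation, any hyperbolic element of the modular group can be written as a word in positive powers of L and R involving both letters.) -/
abbrev SLZ := Matrix.SpecialLinearGroup (Fin 2) ℤ

lemma slz_det (A : SLZ) : A.1 0 0 * A.1 1 1 - A.1 0 1 * A.1 1 0 = 1 := by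
  have := A.2
  rwa [Matrix.det_fin_two] at this

lemma L_val : L.1 = !![1, 1; 0, 1] := rfl
lemma R_val : R.1 = !![1, 0; 1, 1] := rfl
lemma L_inv_val : (L⁻¹).1 = !![1, -1; 0, 1] := by
  rw [Matrix.SpecialLinearGroup.coe_inv, L_val, Matrix.adjugate_fin_two_of]
  simp
lemma R_inv_val : (R⁻¹).1 = !![1, 0; -1, 1] := by
  rw [Matrix.SpecialLinearGroup.coe_inv, R_val, Matrix.adjugate_fin_two_of]
  simp

lemma conjL (A : SLZ) : (L * A * L⁻¹).1 = !![A.1 0 0 + A.1 1 0,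
    A.1 0 1 + A.1 1 1 - A.1 0 0 - A.1 1 0; A.1 1 0, A.1 1 1 - A.1 1 0] := by
  rw [Matrix.SpecialLinearGroup.coe_mul, Matrix.SpecialLinearGroup.coe_mul, L_val, L_inv_val]
  ext i j
  fin_cases i <;> fin_cases j <;>
    simp [Matrix.mul_apply, Fin.sum_univ_two, Matrix.vecMul, dotProduct] <;> try ring

lemma conjL' (A : SLZ) : (L⁻¹ * A * L⁻¹⁻¹).1 = !![A.1 0 0 - A.1 1 0,
    A.1 0 1 - A.1 1 1 + A.1 0 0 - A.1 1 0; A.1 1 0, A.1 1 1 + A.1 1 0] := by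
  rw [inv_inv]
  rw [Matrix.SpecialLinearGroup.coe_mul, Matrix.SpecialLinearGroup.coe_mul, L_val, L_inv_val]
  ext i j
  fin_cases i <;> fin_cases j <;>
    simp [Matrix.mul_apply, Fin.sum_univ_two, Matrix.vecMul, dotProduct] <;> try ring

lemma conjR (A : SLZ) : (R * A * R⁻¹).1 = !![A.1 0 0 - A.1 0 1, A.1 0 1;
    A.1 1 0 + A.1 0 0 - A.1 1 1 - A.1 0 1, A.1 1 1 + A.1 0 1] := by
  rw [Matrix.SpecialLinearGroup.coe_mul, Matrix.SpecialLinearGroup.coe_mul, R_val, R_inv_val]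
  ext i j
  fin_cases i <;> fin_cases j <;>
    simp [Matrix.mul_apply, Fin.sum_univ_two, Matrix.vecMul, dotProduct] <;> try ring

lemma conjR' (A : SLZ) : (R⁻¹ * A * R⁻¹⁻¹).1 = !![A.1 0 0 + A.1 0 1, A.1 0 1;
    A.1 1 0 - A.1 0 0 + A.1 1 1 - A.1 0 1, A.1 1 1 - A.1 0 1] := by
  rw [inv_inv]
  rw [Matrix.SpecialLinearGroup.coe_mul, Matrix.SpecialLinearGroup.coe_mul, R_val, R_inv_val]
  ext i j
  fin_cases i <;> fin_cases j <;>
    simp [Matrix.mul_apply, Fin.sum_univ_two, Matrix.vecMul, dotProduct] <;> try ring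

def Wmat : SLZ := ⟨!![0, 1; -1, 0], by norm_num [Matrix.det_fin_two_of]⟩

lemma W_val : Wmat.1 = !![0, 1; -1, 0] := rfl
lemma W_inv_val : (Wmat⁻¹).1 = !![0, -1; 1, 0] := by
  rw [Matrix.SpecialLinearGroup.coe_inv, W_val, Matrix.adjugate_fin_two_of]
  simp

lemma conjW (A : SLZ) : (Wmat * A * Wmat⁻¹).1 =
    !![A.1 1 1, - A.1 1 0; - A.1 0 1, A.1 0 0] := by
  rw [Matrix.SpecialLinearGroup.coe_mul, Matrix.SpecialLinearGroup.coe_mul, W_val, W_inv_val]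
  ext i j
  fin_cases i <;> fin_cases j <;>
    simp [Matrix.mul_apply, Fin.sum_univ_two, Matrix.vecMul, dotProduct]

lemma word_of_nonneg (n : ℕ) : ∀ A : SLZ, 0 ≤ A.1 0 0 → 0 ≤ A.1 0 1 → 0 ≤ A.1 1 0 → 0 ≤ A.1 1 1 →
    A.1 0 0 + A.1 0 1 + A.1 1 0 + A.1 1 1 ≤ n →
    ∃ l : List SLZ, (∀ M ∈ l, M = L ∨ M = R) ∧ A = l.prod := by
  induction n with
  | zero =>
    intro A h1 h2 h3 h4 h5
    have hd := slz_det A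
    have : A.1 0 0 = 0 := by push_cast at h5; linarith
    have h' : A.1 0 1 = 0 := by push_cast at h5; linarith
    rw [this, h'] at hd
    norm_num at hd
  | succ n ih =>
    intro A h1 h2 h3 h4 h5
    push_cast at h5
    have hd := slz_det A
    by_cases hL : A.1 1 0 ≤ A.1 0 0 ∧ A.1 1 1 ≤ A.1 0 1
    · have e : (L⁻¹ * A).1 = !![A.1 0 0 - A.1 1 0, A.1 0 1 - A.1 1 1; A.1 1 0, A.1 1 1] := by
        rw [Matrix.SpecialLinearGroup.coe_mul, L_inv_val]
        ext i j
        fin_cases i <;> fin_cases j <;>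
          simp [Matrix.mul_apply, Fin.sum_univ_two, Matrix.vecMul, dotProduct] <;> try ring
      have hpos : 0 < A.1 1 0 + A.1 1 1 := by
        by_contra hc
        have e1 : A.1 1 0 = 0 := by linarith
        have e2 : A.1 1 1 = 0 := by linarith
        rw [e1, e2] at hd
        norm_num at hd
      obtain ⟨l, hl, hp⟩ := ih (L⁻¹ * A) (by rw [e]; simp; linarith) (by rw [e]; simp; linarith)
        (by rw [e]; simpa using h3) (by rw [e]; simpa using h4) (by rw [e]; simp; linarith)
      refine ⟨L :: l, ?_, ?_⟩
      · intro M hM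
        rcases List.mem_cons.1 hM with h | h
        · exact Or.inl h
        · exact hl M h
      · rw [List.prod_cons, ← hp, mul_inv_cancel_left]
    by_cases hR : A.1 0 0 ≤ A.1 1 0 ∧ A.1 0 1 ≤ A.1 1 1
    · have e : (R⁻¹ * A).1 = !![A.1 0 0, A.1 0 1; A.1 1 0 - A.1 0 0, A.1 1 1 - A.1 0 1] := by
        rw [Matrix.SpecialLinearGroup.coe_mul, R_inv_val]
        ext i j
        fin_cases i <;> fin_cases j <;>
          simp [Matrix.mul_apply, Fin.sum_univ_two, Matrix.vecMul, dotProduct] <;> try ring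
      have hpos : 0 < A.1 0 0 + A.1 0 1 := by
        by_contra hc
        have e1 : A.1 0 0 = 0 := by linarith
        have e2 : A.1 0 1 = 0 := by linarith
        rw [e1, e2] at hd
        norm_num at hd
      obtain ⟨l, hl, hp⟩ := ih (R⁻¹ * A) (by rw [e]; simpa using h1) (by rw [e]; simpa using h2)
        (by rw [e]; simp; linarith) (by rw [e]; simp; linarith) (by rw [e]; simp; linarith)
      refine ⟨R :: l, ?_, ?_⟩
      · intro M hM
        rcases List.mem_cons.1 hM with h | h
        · exact Or.inr h
        · exact hl M h
      · rw [List.prod_cons, ← hp, mul_inv_cancel_left]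
    refine ⟨[], by simp, ?_⟩
    rcases le_or_gt (A.1 0 0) (A.1 1 0) with hac | hac
    · have : A.1 1 1 < A.1 0 1 := by
        by_contra hc
        exact hR ⟨hac, by linarith⟩
      exfalso
      nlinarith
    · have hbd : A.1 0 1 < A.1 1 1 := by
        by_contra hc
        exact hL ⟨hac.le, by linarith⟩
      have key : (A.1 1 0 + 1) * (A.1 0 1 + 1) ≤ A.1 0 0 * A.1 1 1 :=
        mul_le_mul (by linarith) (by linarith) (by linarith) h1
      have hb : A.1 0 1 = 0 := by nlinarith
      have hc : A.1 1 0 = 0 := by nlinarith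
      rw [hb, hc] at hd
      have had : A.1 0 0 * A.1 1 1 = 1 := by linarith
      have ha : A.1 0 0 = 1 := by nlinarith
      have hdd : A.1 1 1 = 1 := by nlinarith
      ext i j
      fin_cases i <;> fin_cases j <;> simp [ha, hb, hc, hdd]

lemma allL_prod (l : List SLZ) (h : ∀ M ∈ l, M = L) :
    l.prod.1 0 0 = 1 ∧ l.prod.1 1 0 = 0 ∧ l.prod.1 1 1 = 1 := by
  induction l with
  | nil => simp
  | cons M l ih =>
    obtain ⟨h1, h2, h3⟩ := ih fun N hN => h N (List.mem_cons_of_mem _ hN)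
    have hM := h M List.mem_cons_self
    subst hM
    rw [List.prod_cons]
    simp only [Matrix.SpecialLinearGroup.coe_mul, Matrix.mul_apply, Fin.sum_univ_two, h1, h2, h3]
    simp [L]

lemma allR_prod (l : List SLZ) (h : ∀ M ∈ l, M = R) :
    l.prod.1 0 0 = 1 ∧ l.prod.1 0 1 = 0 ∧ l.prod.1 1 1 = 1 := by
  induction l with
  | nil => simp
  | cons M l ih =>
    obtain ⟨h1, h2, h3⟩ := ih fun N hN => h N (List.mem_cons_of_mem _ hN)
    have hM := h M List.mem_cons_self
    subst hM
    rw [List.prod_cons]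
    simp only [Matrix.SpecialLinearGroup.coe_mul, Matrix.mul_apply, Fin.sum_univ_two, h1, h2, h3]
    simp [R]

def Good (A : SLZ) : Prop := ∃ (B : SLZ) (l : List SLZ),
      (∀ M ∈ l, M = L ∨ M = R) ∧ L ∈ l ∧ R ∈ l ∧ B * A * B⁻¹ = l.prod

lemma Good.of_conj (A C : SLZ) (h : Good (C * A * C⁻¹)) : Good A := by
  obtain ⟨B, l, h1, h2, h3, h4⟩ := h
  refine ⟨B * C, l, h1, h2, h3, ?_⟩
  rw [← h4]
  group

lemma good_of_nonneg (A : SLZ) (ht : 2 < A.1 0 0 + A.1 1 1) (h1 : 0 ≤ A.1 0 0) (h2 : 0 ≤ A.1 0 1)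
    (h3 : 0 ≤ A.1 1 0) (h4 : 0 ≤ A.1 1 1) : Good A := by
  obtain ⟨l, hl, hp⟩ := word_of_nonneg
    (A.1 0 0 + A.1 0 1 + A.1 1 0 + A.1 1 1).toNat A h1 h2 h3 h4 (Int.self_le_toNat _)
  refine ⟨1, l, hl, ?_, ?_, by simpa using hp⟩
  · by_contra hn
    have := allR_prod l fun M hM => (hl M hM).resolve_left fun e => hn (e ▸ hM)
    rw [← hp] at this
    linarith [this.1, this.2.2]
  · by_contra hn
    have := allL_prod l fun M hM => (hl M hM).resolve_right fun e => hn (e ▸ hM)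
    rw [← hp] at this
    linarith [this.1, this.2.2]

lemma good_of_same_sign (A : SLZ) (ht : 2 < A.1 0 0 + A.1 1 1)
    (h : 0 ≤ A.1 0 1 * A.1 1 0) : Good A := by
  have hd := slz_det A
  have had : 0 < A.1 0 0 * A.1 1 1 := by linarith
  have hpos : 0 < A.1 0 0 ∧ 0 < A.1 1 1 := by
    rcases pos_and_pos_or_neg_and_neg_of_mul_pos had with h | h
    · exact h
    · exfalso; linarith [h.1, h.2]
  rcases mul_nonneg_iff.1 h with ⟨hb, hc⟩ | ⟨hb, hc⟩
  · exact good_of_nonneg A ht hpos.1.le hb hc hpos.2.le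
  · apply Good.of_conj A Wmat
    apply good_of_nonneg <;> rw [conjW] <;> simp <;> linarith [hpos.1, hpos.2]

lemma good_of_trace (n : ℕ) : ∀ A : SLZ, 2 < A.1 0 0 + A.1 1 1 →
    |A.1 0 1| + |A.1 1 0| ≤ n → Good A := by
  induction n with
  | zero =>
    intro A ht hn
    have := abs_nonneg (A.1 0 1)
    have := abs_nonneg (A.1 1 0)
    have h0 : A.1 0 1 = 0 := abs_eq_zero.1 (by push_cast at hn; linarith)
    exact good_of_same_sign A ht (by simp [h0])
  | succ n ih =>
    -- the main step, with the sign of the entries normalised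
    have step : ∀ A : SLZ, 2 < A.1 0 0 + A.1 1 1 → A.1 0 1 < 0 → 0 < A.1 1 0 →
        - A.1 0 1 + A.1 1 0 ≤ n + 1 → Good A := by
      intro A ht hb hc hn
      have hd := slz_det A
      have hD : -(4 * A.1 0 1 * A.1 1 0) < (A.1 1 1 - A.1 0 0) ^ 2 := by nlinarith
      rcases le_total (A.1 1 0) (- A.1 0 1) with hcb | hcb
      · have habs : A.1 1 0 < |A.1 1 1 - A.1 0 0| := by
          apply lt_of_pow_lt_pow_left₀ 2 (abs_nonneg _)
          rw [sq_abs]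
          nlinarith
        rcases le_total 0 (A.1 1 1 - A.1 0 0) with hs | hs
        · rw [abs_of_nonneg hs] at habs
          apply Good.of_conj A L
          by_cases hb' : 0 ≤ A.1 0 1 + A.1 1 1 - A.1 0 0 - A.1 1 0
          · apply good_of_same_sign <;> rw [conjL] <;> simp
            · linarith
            · exact mul_nonneg (by linarith) hc.le
          · apply ih <;> rw [conjL] <;> simp
            · linarith
            · rw [abs_of_nonpos (by linarith), abs_of_pos hc]; linarith
        · rw [abs_of_nonpos hs] at habs
          apply Good.of_conj A L⁻¹
          by_cases hb' : 0 ≤ A.1 0 1 - A.1 1 1 + A.1 0 0 - A.1 1 0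
          · apply good_of_same_sign <;> rw [conjL'] <;> simp
            · linarith
            · exact mul_nonneg (by linarith) hc.le
          · apply ih <;> rw [conjL'] <;> simp
            · linarith
            · rw [abs_of_nonpos (by linarith), abs_of_pos hc]; linarith
      · have habs : - A.1 0 1 < |A.1 1 1 - A.1 0 0| := by
          apply lt_of_pow_lt_pow_left₀ 2 (abs_nonneg _)
          rw [sq_abs]
          nlinarith
        rcases le_total 0 (A.1 1 1 - A.1 0 0) with hs | hs
        · rw [abs_of_nonneg hs] at habs
          apply Good.of_conj A R
          by_cases hb' : A.1 1 0 + A.1 0 0 - A.1 1 1 - A.1 0 1 ≤ 0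
          · apply good_of_same_sign <;> rw [conjR] <;> simp
            · linarith
            · exact mul_nonneg_of_nonpos_of_nonpos hb.le (by linarith)
          · apply ih <;> rw [conjR] <;> simp
            · linarith
            · rw [abs_of_neg hb, abs_of_nonneg (by linarith)]; linarith
        · rw [abs_of_nonpos hs] at habs
          apply Good.of_conj A R⁻¹
          by_cases hb' : A.1 1 0 - A.1 0 0 + A.1 1 1 - A.1 0 1 ≤ 0
          · apply good_of_same_sign <;> rw [conjR'] <;> simp
            · linarith
            · exact mul_nonneg_of_nonpos_of_nonpos hb.le (by linarith)
          · apply ih <;> rw [conjR'] <;> simp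
            · linarith
            · rw [abs_of_neg hb, abs_of_nonneg (by linarith)]; linarith
    have step2 : ∀ A : SLZ, 2 < A.1 0 0 + A.1 1 1 → 0 < A.1 0 1 → A.1 1 0 < 0 →
        A.1 0 1 - A.1 1 0 ≤ n + 1 → Good A := by
      intro A ht hb hc hn
      have hd := slz_det A
      have hD : -(4 * A.1 0 1 * A.1 1 0) < (A.1 1 1 - A.1 0 0) ^ 2 := by nlinarith
      rcases le_total (- A.1 1 0) (A.1 0 1) with hcb | hcb
      · have habs : - A.1 1 0 < |A.1 1 1 - A.1 0 0| := by
          apply lt_of_pow_lt_pow_left₀ 2 (abs_nonneg _)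
          rw [sq_abs]
          nlinarith
        rcases le_total 0 (A.1 1 1 - A.1 0 0) with hs | hs
        · rw [abs_of_nonneg hs] at habs
          apply Good.of_conj A L⁻¹
          by_cases hb' : A.1 0 1 - A.1 1 1 + A.1 0 0 - A.1 1 0 ≤ 0
          · apply good_of_same_sign <;> rw [conjL'] <;> simp
            · linarith
            · exact mul_nonneg_of_nonpos_of_nonpos (by linarith) hc.le
          · apply ih <;> rw [conjL'] <;> simp
            · linarith
            · rw [abs_of_nonneg (by linarith), abs_of_neg hc]; linarith
        · rw [abs_of_nonpos hs] at habs
          apply Good.of_conj A L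
          by_cases hb' : A.1 0 1 + A.1 1 1 - A.1 0 0 - A.1 1 0 ≤ 0
          · apply good_of_same_sign <;> rw [conjL] <;> simp
            · linarith
            · exact mul_nonneg_of_nonpos_of_nonpos (by linarith) hc.le
          · apply ih <;> rw [conjL] <;> simp
            · linarith
            · rw [abs_of_nonneg (by linarith), abs_of_neg hc]; linarith
      · have habs : A.1 0 1 < |A.1 1 1 - A.1 0 0| := by
          apply lt_of_pow_lt_pow_left₀ 2 (abs_nonneg _)
          rw [sq_abs]
          nlinarith
        rcases le_total 0 (A.1 1 1 - A.1 0 0) with hs | hs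
        · rw [abs_of_nonneg hs] at habs
          apply Good.of_conj A R⁻¹
          by_cases hb' : 0 ≤ A.1 1 0 - A.1 0 0 + A.1 1 1 - A.1 0 1
          · apply good_of_same_sign <;> rw [conjR'] <;> simp
            · linarith
            · exact mul_nonneg hb.le (by linarith)
          · apply ih <;> rw [conjR'] <;> simp
            · linarith
            · rw [abs_of_pos hb, abs_of_nonpos (by linarith)]; linarith
        · rw [abs_of_nonpos hs] at habs
          apply Good.of_conj A R
          by_cases hb' : 0 ≤ A.1 1 0 + A.1 0 0 - A.1 1 1 - A.1 0 1
          · apply good_of_same_sign <;> rw [conjR] <;> simp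
            · linarith
            · exact mul_nonneg hb.le (by linarith)
          · apply ih <;> rw [conjR] <;> simp
            · linarith
            · rw [abs_of_pos hb, abs_of_nonpos (by linarith)]; linarith
    intro A ht hn
    push_cast at hn
    by_cases hs : 0 ≤ A.1 0 1 * A.1 1 0
    · exact good_of_same_sign A ht hs
    rcases mul_neg_iff.1 (not_le.1 hs) with ⟨hb, hc⟩ | ⟨hb, hc⟩
    · rw [abs_of_pos hb, abs_of_neg hc] at hn
      exact step2 A ht hb hc (by linarith)
    · rw [abs_of_neg hb, abs_of_pos hc] at hn
      exact step A ht hb hc hn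

/-- Up to conjugation, any hyperbolic element of the modular group (trace `> 2`)
can be written as a word in positive powers of `L` and `R` involving both
letters. The word is encoded as a list of matrices each equal to `L` or `R`,
containing at least one `L` and at least one `R`. -/
theorem hyperbolic_conjugate_to_LR_word (A : Matrix.SpecialLinearGroup (Fin 2) ℤ)
    (hA : 2 < Matrix.trace ((A : Matrix.SpecialLinearGroup (Fin 2) ℤ) :
      Matrix (Fin 2) (Fin 2) ℤ)) :
    ∃ (B : Matrix.SpecialLinearGroup (Fin 2) ℤ)
      (l : List (Matrix.SpecialLinearGroup (Fin 2) ℤ)),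
      (∀ M ∈ l, M = L ∨ M = R) ∧ L ∈ l ∧ R ∈ l ∧ B * A * B⁻¹ = l.prod := by
  rw [Matrix.trace_fin_two] at hA
  exact good_of_trace (|A.1 0 1| + |A.1 1 0|).toNat A hA (Int.self_le_toNat _)
end

section
/- For every n ≥ 1, the traces of the matrices A_n satisfy 3·trace(A_n) ≤ 2·trace(A_{n+1}) and trace(A_{n+1}) ≤ 4·trace(A_n) (that is, (3/2)·trace(A_n) ≤ trace(A_{n+1}) ≤ 4·trace(A_n)). -/
/-- For `n ≥ 1`, the matrix `A_n = L·R·(R·L)^{n-1}` of the modular geodesic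
`γ_n` with cutting sequence `LR(RL)^{n-1}`. -/
def A (n : ℕ) : Matrix.SpecialLinearGroup (Fin 2) ℤ :=
  L * R * (R * L) ^ (n - 1)

/-- Right multiplication by `R * L` on entries. -/
theorem A_succ_entries (k : ℕ) :
    (A (k + 2)).1 = !![(A (k + 1)).1 0 0 + (A (k + 1)).1 0 1,
        (A (k + 1)).1 0 0 + 2 * (A (k + 1)).1 0 1;
      (A (k + 1)).1 1 0 + (A (k + 1)).1 1 1,
        (A (k + 1)).1 1 0 + 2 * (A (k + 1)).1 1 1] := by
  have h : A (k + 2) = A (k + 1) * (R * L) := by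
    simp only [A, Nat.add_sub_cancel, show k + 2 - 1 = k + 1 from rfl, pow_succ, mul_assoc]
  have h2 : (R * L).1 = !![1, 1; 1, 2] := by decide
  have h3 : (A (k + 2)).1 = (A (k + 1)).1 * (R * L).1 := by rw [h]; rfl
  rw [h3, h2]
  ext i j
  fin_cases i <;> fin_cases j <;> simp [Matrix.mul_apply, Fin.sum_univ_two] <;> ring

/-- For every `n ≥ 1`, `(3/2)·trace(A_n) ≤ trace(A_{n+1}) ≤ 4·trace(A_n)`,
stated over `ℤ` as `3·trace(A_n) ≤ 2·trace(A_{n+1})` and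
`trace(A_{n+1}) ≤ 4·trace(A_n)`. -/
theorem trace_A_succ_bounds (n : ℕ) (hn : 1 ≤ n) :
    3 * Matrix.trace ((A n : Matrix.SpecialLinearGroup (Fin 2) ℤ) :
        Matrix (Fin 2) (Fin 2) ℤ) ≤
      2 * Matrix.trace ((A (n + 1) : Matrix.SpecialLinearGroup (Fin 2) ℤ) :
        Matrix (Fin 2) (Fin 2) ℤ) ∧
    Matrix.trace ((A (n + 1) : Matrix.SpecialLinearGroup (Fin 2) ℤ) :
        Matrix (Fin 2) (Fin 2) ℤ) ≤
      4 * Matrix.trace ((A n : Matrix.SpecialLinearGroup (Fin 2) ℤ) :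
        Matrix (Fin 2) (Fin 2) ℤ) := by
  obtain ⟨k, rfl⟩ : ∃ k, n = k + 1 := ⟨n - 1, by omega⟩
  have key : ∀ k : ℕ, 0 ≤ (A (k + 1)).1.trace ∧
      3 * (A (k + 1)).1.trace ≤ 2 * (A (k + 2)).1.trace ∧
      (A (k + 2)).1.trace ≤ 4 * (A (k + 1)).1.trace := by
    intro k
    induction k with
    | zero => decide
    | succ k ih =>
      have h1 := A_succ_entries k
      have h2 := A_succ_entries (k + 1)
      rw [show k + 1 + 2 = k + 3 from rfl, show k + 1 + 1 = k + 2 from rfl] at *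
      rw [h1] at h2 ih
      rw [h2, h1]
      simp only [Matrix.trace_fin_two, Matrix.of_apply, Matrix.cons_val', Matrix.cons_val_zero,
        Matrix.cons_val_one, Matrix.cons_val_fin_one] at ih ⊢
      omega
  exact (key k).2
end

section
/- For every n ≥ 1, the trace of A_n, regarded as a real number, satisfies (3/2)ⁿ ≤ trace(A_n) ≤ 4ⁿ. -/
/-- The trace of `A_n`, an integer. -/
def traceA (n : ℕ) : ℤ :=
  Matrix.trace ((A n : Matrix.SpecialLinearGroup (Fin 2) ℤ) :
    Matrix (Fin 2) (Fin 2) ℤ)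

/-- Entries of `A_{k+1}` are nonnegative, and its trace grows by a factor in `[3/2, 4]`. -/
lemma entries_bounds (k : ℕ) : ∃ a b c d : ℤ,
    ((A (k + 1) : Matrix.SpecialLinearGroup (Fin 2) ℤ) : Matrix (Fin 2) (Fin 2) ℤ)
      = !![a, b; c, d] ∧ 0 ≤ a ∧ 0 ≤ b ∧ 0 ≤ c ∧ 0 ≤ d ∧
    a ≤ 2 * b + 2 * c + d ∧ b + c ≤ 3 * a + 2 * d ∧
    (3 / 2 : ℝ) ^ (k + 1) ≤ ((a + d : ℤ) : ℝ) ∧ ((a + d : ℤ) : ℝ) ≤ (4 : ℝ) ^ (k + 1) := by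
  induction k with
  | zero =>
    refine ⟨2, 1, 1, 1, ?_, ?_⟩
    · have h : A (0 + 1) = L * R := by simp [A]
      rw [h]
      decide
    · norm_num
  | succ k ih =>
    obtain ⟨a, b, c, d, hM, ha, hb, hc, hd, h1, h2, h3, h4⟩ := ih
    have hA : A (k + 1 + 1) = A (k + 1) * (R * L) := by
      simp [A, pow_succ, mul_assoc]
    have h1' : (a : ℝ) ≤ 2 * b + 2 * c + d := by exact_mod_cast h1
    have h2' : (b : ℝ) + c ≤ 3 * a + 2 * d := by exact_mod_cast h2
    push_cast at h3 h4
    refine ⟨a + b, a + 2 * b, c + d, c + 2 * d, ?_, by omega, by omega, by omega, by omega,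
      by omega, by omega, ?_, ?_⟩
    · have hRL : ((R * L : Matrix.SpecialLinearGroup (Fin 2) ℤ) : Matrix (Fin 2) (Fin 2) ℤ)
          = !![1, 1; 1, 2] := by decide
      rw [hA, Matrix.SpecialLinearGroup.coe_mul, hM, hRL, Matrix.mul_fin_two]
      simp [mul_comm]
    · rw [pow_succ]; push_cast; linarith
    · rw [pow_succ]; push_cast; linarith

/-- For every `n ≥ 1`, the trace of `A_n`, regarded as a real number,
satisfies `(3/2)ⁿ ≤ trace(A_n) ≤ 4ⁿ`. -/
theorem trace_A_pow_bounds (n : ℕ) (hn : 1 ≤ n) :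
    (3 / 2 : ℝ) ^ n ≤ (traceA n : ℝ) ∧ (traceA n : ℝ) ≤ (4 : ℝ) ^ n := by
  obtain ⟨k, rfl⟩ : ∃ k, n = k + 1 := ⟨n - 1, by omega⟩
  obtain ⟨a, b, c, d, hM, -, -, -, -, -, -, h3, h4⟩ := entries_bounds k
  have ht : traceA (k + 1) = a + d := by
    rw [traceA, hM, Matrix.trace_fin_two_of]
  rw [ht]
  exact ⟨h3, h4⟩
end

section
/- For n ≥ 1 let t_n := trace(A_n), regarded as a real number, and let λ_n := (t_n + √(t_n² − 4))/2 be the eigenvalue of A_n of absolute value greater than 1. Then n·log(3/2) ≤ 2·log(λ_n) ≤ 2n·log(4); that is, the hyperbolic length ℓ(γ_n) = 2·log(λ_n) of the modular geodesic γ_n grows linearly in n. -/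
/-- The trace `t_n` of `A_n`, regarded as a real number. -/
noncomputable def t (n : ℕ) : ℝ :=
  (Matrix.trace ((A n : Matrix.SpecialLinearGroup (Fin 2) ℤ) :
    Matrix (Fin 2) (Fin 2) ℤ) : ℤ)

/-- The eigenvalue `λ_n = (t_n + √(t_n² - 4))/2` of `A_n` of absolute value
greater than `1`. -/
noncomputable def lam (n : ℕ) : ℝ :=
  (t n + Real.sqrt (t n ^ 2 - 4)) / 2

theorem aux_bounds (k : ℕ) : ∃ a b c d : ℤ, 0 ≤ a ∧ 0 ≤ b ∧ 0 ≤ c ∧ 0 ≤ d ∧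
    (((R * L) ^ k : Matrix.SpecialLinearGroup (Fin 2) ℤ) : Matrix (Fin 2) (Fin 2) ℤ)
      = !![a, b; c, d] ∧
    2 * (3 / 2 : ℝ) ^ (k + 1) ≤ 2 * a + b + c + d ∧
    (2 * a + b + c + d : ℝ) ≤ 4 ^ (k + 1) := by
  induction k with
  | zero =>
    refine ⟨1, 0, 0, 1, by norm_num, by norm_num, by norm_num, by norm_num, ?_, ?_, ?_⟩
    · simp [Matrix.one_fin_two]
    · norm_num
    · norm_num
  | succ k ih =>
    obtain ⟨a, b, c, d, ha, hb, hc, hd, hM, h1, h2⟩ := ih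
    refine ⟨a + b, a + 2 * b, c + d, c + 2 * d, by positivity, by positivity, by positivity,
      by positivity, ?_, ?_, ?_⟩
    · rw [pow_succ, Matrix.SpecialLinearGroup.coe_mul, hM, Matrix.SpecialLinearGroup.coe_mul]
      simp only [L, R, Matrix.mul_fin_two]
      congr! 1
      ext i j
      fin_cases i <;> fin_cases j <;> simp <;> ring
    all_goals
      have ha' : (0 : ℝ) ≤ a := by exact_mod_cast ha
      have hb' : (0 : ℝ) ≤ b := by exact_mod_cast hb
      have hc' : (0 : ℝ) ≤ c := by exact_mod_cast hc
      have hd' : (0 : ℝ) ≤ d := by exact_mod_cast hd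
      rw [pow_succ]
      push_cast
      linarith

theorem t_bounds (n : ℕ) (hn : 1 ≤ n) : 2 * (3 / 2 : ℝ) ^ n ≤ t n ∧ t n ≤ 4 ^ n := by
  obtain ⟨k, rfl⟩ : ∃ k, n = k + 1 := ⟨n - 1, by omega⟩
  obtain ⟨a, b, c, d, -, -, -, -, hM, h1, h2⟩ := aux_bounds k
  have ht : t (k + 1) = 2 * a + b + c + d := by
    unfold t A
    rw [Nat.add_sub_cancel, Matrix.SpecialLinearGroup.coe_mul, hM,
      Matrix.SpecialLinearGroup.coe_mul]
    simp only [L, R, Matrix.mul_fin_two, Matrix.trace_fin_two_of]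
    push_cast
    ring
  rw [ht]
  exact ⟨h1, h2⟩

/-- For every `n ≥ 1`, the hyperbolic length `ℓ(γ_n) = 2·log(λ_n)` of the
modular geodesic `γ_n` satisfies `n·log(3/2) ≤ 2·log(λ_n) ≤ 2n·log(4)`. -/
theorem length_modular_geodesic_bounds (n : ℕ) (hn : 1 ≤ n) :
    (n : ℝ) * Real.log (3 / 2) ≤ 2 * Real.log (lam n) ∧
    2 * Real.log (lam n) ≤ 2 * (n : ℝ) * Real.log 4 := by
  obtain ⟨h1, h2⟩ := t_bounds n hn
  have hp : (1 : ℝ) ≤ (3 / 2 : ℝ) ^ n := one_le_pow₀ (by norm_num)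
  have hs0 := Real.sqrt_nonneg (t n ^ 2 - 4)
  have hs1 : Real.sqrt (t n ^ 2 - 4) ≤ t n :=
    Real.sqrt_le_iff.mpr ⟨by linarith, by linarith⟩
  have l1 : (3 / 2 : ℝ) ^ n ≤ lam n := by unfold lam; linarith
  have l2 : lam n ≤ 4 ^ n := by unfold lam; linarith
  have g1 := Real.log_le_log (by linarith) l1
  have g2 := Real.log_le_log (by linarith) l2
  have g0 := Real.log_nonneg hp
  rw [Real.log_pow] at g0 g1 g2
  constructor <;> linarith
end
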